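/- Let G be a finite group and H, K ≤ G. Then H and K are almost conjugate (i.e., |H ∩ [g]| = |K ∩ [g]| for every G-conjugacy class [g]) if and only if for every finite-dimensional complex representation ρ of G, the dimension of the fixed subspace of ρ(H) equals the dimension of the fixed subspace of ρ(K). -/

import Mathlib

/-- `H` and `K` are almost conjugate in `G`: each conjugacy class meets them
in sets of equal cardinality. -/
def AlmostConjugate {G : Type*} [Group G] (H K : Subgroup G) : Prop :=
  ∀ g : G, Nat.card {x : G // x ∈ H ∧ IsConj g x} = Nat.card {x : G // x ∈ K ∧ IsConj g x}

/-- The subspace of vectors fixed by every element of the subgroup `H` under the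
representation `ρ`. -/
def fixedSubspace {G : Type*} [Group G] {V : Type*} [AddCommGroup V] [Module ℂ V]
    (ρ : Representation ℂ G V) (H : Subgroup G) : Submodule ℂ V :=
  ⨅ h : H, LinearMap.ker ((ρ (h : G) : Module.End ℂ V) - 1)

section ConjugatorCount

variable {G : Type*} [Group G]

/-- The number of `g : G` conjugating `x` into `H`. It equals `|H|` times the character at `x`
of the permutation representation on `G ⧸ H`. -/
noncomputable def conjugatorCount (H : Subgroup G) (x : G) : ℕ :=
  Nat.card {g : G // g * x * g⁻¹ ∈ H}

theorem card_conjugators_eq_card_centralizer {x y : G} (h : IsConj x y) :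
    Nat.card {g : G // g * x * g⁻¹ = y} = Nat.card (Subgroup.centralizer {x}) := by
  obtain ⟨c, rfl⟩ := isConj_iff.1 h
  refine Nat.card_congr ((Equiv.mulLeft c⁻¹).subtypeEquiv fun g => ?_)
  rw [Subgroup.mem_centralizer_singleton_iff, Equiv.coe_mulLeft]
  constructor
  · intro h
    have : g * x = c * x * c⁻¹ * g := by rw [← h]; group
    rw [mul_assoc, this]; group
  · intro h
    have : g * x = c * (c⁻¹ * g * x) := by group
    rw [this, h]; group

theorem conjugatorCount_eq_mul [Finite G] (H : Subgroup G) (x : G) :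
    conjugatorCount H x =
      Nat.card {y : G // y ∈ H ∧ IsConj x y} * Nat.card (Subgroup.centralizer {x}) := by
  let e : {g : G // g * x * g⁻¹ ∈ H} ≃
      Σ y : {y : G // y ∈ H ∧ IsConj x y}, {g : G // g * x * g⁻¹ = y} :=
    { toFun := fun g => ⟨⟨g.1 * x * g.1⁻¹, g.2, isConj_iff.2 ⟨g.1, rfl⟩⟩, g.1, rfl⟩
      invFun := fun p => ⟨p.2, p.2.2.symm ▸ p.1.2.1⟩
      left_inv := fun _ => rfl
      right_inv := by rintro ⟨⟨y, hy⟩, g, hg⟩; cases hg; rfl }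
  have := Fintype.ofFinite {y : G // y ∈ H ∧ IsConj x y}
  rw [conjugatorCount, Nat.card_congr e, Nat.card_sigma,
    Finset.sum_congr rfl fun y _ => card_conjugators_eq_card_centralizer y.2.2,
    Finset.sum_const, Finset.card_univ, smul_eq_mul, ← Nat.card_eq_fintype_card]

theorem almostConjugate_iff_conjugatorCount_eq [Finite G] (H K : Subgroup G) :
    AlmostConjugate H K ↔ conjugatorCount H = conjugatorCount K := by
  simp only [AlmostConjugate, funext_iff, conjugatorCount_eq_mul]
  exact forall_congr' fun x => (Nat.mul_left_inj Nat.card_pos.ne').symm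

theorem conjugatorCount_one (H : Subgroup G) : conjugatorCount H 1 = Nat.card G := by
  simp only [conjugatorCount, mul_one, mul_inv_cancel, one_mem]
  exact Nat.card_congr (Equiv.subtypeUnivEquiv fun _ => trivial)

theorem conjugatorCount_inv (H : Subgroup G) (x : G) :
    conjugatorCount H x⁻¹ = conjugatorCount H x := by
  refine Nat.card_congr (Equiv.subtypeEquivRight fun g => ?_)
  rw [← inv_mem_iff]
  simp [mul_assoc]

theorem conjugatorCount_conj (H : Subgroup G) (g x : G) :
    conjugatorCount H (g * x * g⁻¹) = conjugatorCount H x :=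
  Nat.card_congr ((Equiv.mulRight g).subtypeEquiv fun a => by simp [mul_assoc])

theorem sum_conjugatorCount_mul [Fintype G] {R : Type*} [CommSemiring R] (H : Subgroup G)
    [Fintype H] (f : G → R) (hf : ∀ g x, f (g * x * g⁻¹) = f x) :
    ∑ x, (conjugatorCount H x : R) * f x = Nat.card G * ∑ h : H, f h := by
  classical
  have hcount (x : G) : (conjugatorCount H x : R) = ∑ g : G, if g * x * g⁻¹ ∈ H then 1 else 0 := by
    rw [conjugatorCount, Nat.card_eq_fintype_card, Fintype.card_subtype, Finset.sum_boole]
  have hconj (g : G) :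
      ∑ x : G, (if g * x * g⁻¹ ∈ H then 1 else 0) * f x = ∑ h : H, f h := by
    calc
      _ = ∑ x : G, if MulAut.conj g x ∈ H then f (MulAut.conj g x) else 0 := by
        simp [hf]
      _ = ∑ x : G, if x ∈ H then f x else 0 :=
        Equiv.sum_comp (MulAut.conj g).toEquiv fun x => if x ∈ H then f x else 0
      _ = _ := by
        rw [← Finset.sum_filter]
        exact Finset.sum_subtype _ (by simp) f
  simp_rw [hcount, Finset.sum_mul]
  rw [Finset.sum_comm, Finset.sum_congr rfl fun g _ => hconj g]
  simp

theorem AlmostConjugate.card_eq [Finite G] {H K : Subgroup G} (h : AlmostConjugate H K) :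
    Nat.card H = Nat.card K := by
  have := Fintype.ofFinite G
  have := Fintype.ofFinite H
  have := Fintype.ofFinite K
  have hH := sum_conjugatorCount_mul H (fun _ => (1 : ℕ)) fun _ _ => rfl
  have hK := sum_conjugatorCount_mul K (fun _ => (1 : ℕ)) fun _ _ => rfl
  rw [(almostConjugate_iff_conjugatorCount_eq H K).1 h, hK] at hH
  simpa [Nat.card_eq_fintype_card] using (Nat.eq_of_mul_eq_mul_left Nat.card_pos hH).symm

end ConjugatorCount

section FixedSubspace

variable {G : Type*} [Group G] {V : Type*} [AddCommGroup V] [Module ℂ V]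
  (ρ : Representation ℂ G V)

theorem fixedSubspace_eq_invariants (H : Subgroup G) :
    fixedSubspace ρ H = Representation.invariants (ρ.comp H.subtype) := by
  ext v
  simp [fixedSubspace, Representation.mem_invariants, sub_eq_zero]

theorem sum_conjugatorCount_mul_character [Fintype G] [FiniteDimensional ℂ V] (H : Subgroup G) :
    ∑ x, (conjugatorCount H x : ℂ) * ρ.character x =
      Nat.card G * (Nat.card H * Module.finrank ℂ (fixedSubspace ρ H)) := by
  have := Fintype.ofFinite H
  have hH : (Nat.card H : ℂ) ≠ 0 := Nat.cast_ne_zero.2 Nat.card_pos.ne'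
  have := invertibleOfNonzero hH
  rw [sum_conjugatorCount_mul H ρ.character fun g x => ρ.char_conj x g,
    fixedSubspace_eq_invariants, ← Representation.card_inv_mul_sum_char_eq_finrank,
    mul_inv_cancel_left₀ hH]
  rfl

end FixedSubspace

section ClassFunction

variable {G : Type*} [Group G]

theorem sum_mul_character_eq_zero_of_fin [Fintype G] {F : G → ℂ}
    (hF : ∀ (n : ℕ) (ρ : Representation ℂ G (Fin n → ℂ)), ∑ x, F x * ρ.character x = 0)
    {V : Type*} [AddCommGroup V] [Module ℂ V] [FiniteDimensional ℂ V]
    (ρ : Representation ℂ G V) : ∑ x, F x * ρ.character x = 0 := by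
  let e := (Module.finBasis ℂ V).equivFun
  rw [← hF _ (e.conjRingEquiv.toMulEquiv.toMonoidHom.comp ρ)]
  exact Finset.sum_congr rfl fun x _ => congrArg _ (LinearMap.trace_conj' (ρ x) e).symm

theorem sum_mul_character_eq_trace [Fintype G] (F : G → ℂ)
    {V : Type*} [AddCommGroup V] [Module ℂ V] (ρ : Representation ℂ G V) :
    ∑ x, F x * ρ.character x = LinearMap.trace ℂ V (∑ x, F x • ρ x) := by
  simp [Representation.character]

theorem commute_sum_smul_of_classFunction [Fintype G] {F : G → ℂ}
    (hconj : ∀ g x, F (g * x * g⁻¹) = F x)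
    {V : Type*} [AddCommGroup V] [Module ℂ V] (ρ : Representation ℂ G V) (g : G) :
    Commute (ρ g) (∑ x, F x • ρ x) := by
  rw [Commute, SemiconjBy, Finset.mul_sum, Finset.sum_mul]
  refine Fintype.sum_equiv (MulAut.conj g).toEquiv _ _ fun x => ?_
  simp [hconj, ← map_mul]

/-- If a class function is orthogonal to all characters, the central element it defines acts on
every finite-dimensional representation with zero as its only possible eigenvalue. -/
theorem eigenvalue_eq_zero_of_sum_mul_character_eq_zero [Fintype G] {F : G → ℂ}
    (hconj : ∀ g x, F (g * x * g⁻¹) = F x)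
    (hF : ∀ (n : ℕ) (ρ : Representation ℂ G (Fin n → ℂ)), ∑ x, F x * ρ.character x = 0)
    {V : Type*} [AddCommGroup V] [Module ℂ V] [FiniteDimensional ℂ V]
    (ρ : Representation ℂ G V) {μ : ℂ}
    (hμ : Module.End.HasEigenvalue (∑ x, F x • ρ x) μ) : μ = 0 := by
  let E : Subrepresentation ρ :=
    ⟨Module.End.eigenspace (∑ x, F x • ρ x) μ, fun g v hv => by
      rw [Module.End.mem_eigenspace_iff] at hv ⊢
      rw [← Module.End.mul_apply, ← (commute_sum_smul_of_classFunction hconj ρ g).eq,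
        Module.End.mul_apply, hv, map_smul]⟩
  have hE : ∑ x, F x • E.toRepresentation x = μ • 1 := by
    ext v
    have hv := Module.End.mem_eigenspace_iff.1 v.2
    simpa [Subrepresentation.toRepresentation] using hv
  have htrace := sum_mul_character_eq_zero_of_fin hF E.toRepresentation
  rw [sum_mul_character_eq_trace, hE, map_smul, LinearMap.trace_one, smul_eq_mul] at htrace
  refine (mul_eq_zero.1 htrace).resolve_right (Nat.cast_ne_zero.2 fun h => hμ ?_)
  exact Submodule.finrank_eq_zero.1 h

/-- The left regular representation on functions. -/
def functionRepresentation (G : Type*) [Group G] : Representation ℂ G (G → ℂ) where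
  toFun g := LinearMap.funLeft ℂ ℂ fun x => g⁻¹ * x
  map_one' := by ext; simp [LinearMap.funLeft]
  map_mul' g h := by ext; simp [LinearMap.funLeft, mul_assoc]

theorem sum_smul_functionRepresentation_apply [Fintype G] (F f : G → ℂ) :
    (∑ x, F x • functionRepresentation G x) f =
      (Matrix.of fun x y : G => F (x * y⁻¹)).mulVec f := by
  ext x
  simp only [LinearMap.sum_apply, LinearMap.smul_apply, Finset.sum_apply, Pi.smul_apply,
    smul_eq_mul, Matrix.mulVec, dotProduct, Matrix.of_apply]
  refine Fintype.sum_equiv ((Equiv.inv G).trans (Equiv.mulRight x)) _ _ fun y => ?_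
  simp [functionRepresentation, LinearMap.funLeft]

/-- A Hermitian class function orthogonal to all characters vanishes. -/
theorem classFunction_eq_zero_of_sum_mul_character_eq_zero [Fintype G] {F : G → ℂ}
    (hconj : ∀ g x, F (g * x * g⁻¹) = F x) (hinv : ∀ x, star (F x) = F x⁻¹)
    (hF : ∀ (n : ℕ) (ρ : Representation ℂ G (Fin n → ℂ)), ∑ x, F x * ρ.character x = 0) :
    F = 0 := by
  classical
  let M : Matrix G G ℂ := Matrix.of fun x y => F (x * y⁻¹)
  have hM : M.IsHermitian := by
    ext x y
    simpa [M] using hinv (y * x⁻¹)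
  have hzero : hM.eigenvalues = 0 := by
    ext i
    have hμ : Module.End.HasEigenvalue (∑ x, F x • functionRepresentation G x)
        (hM.eigenvalues i : ℂ) := by
      refine Module.End.hasEigenvalue_of_hasEigenvector
        (x := ⇑(hM.eigenvectorBasis i)) ⟨Module.End.mem_eigenspace_iff.2 ?_, ?_⟩
      · rw [sum_smul_functionRepresentation_apply]
        exact hM.mulVec_eigenvectorBasis i
      · intro h
        exact hM.eigenvectorBasis.toBasis.ne_zero i (by ext x; simpa using congrFun h x)
    simpa using eigenvalue_eq_zero_of_sum_mul_character_eq_zero hconj hF _ hμ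
  have hM0 : M = 0 := hM.eigenvalues_eq_zero_iff.1 hzero
  ext x
  simpa [M] using congrFun (congrFun hM0 x) 1

end ClassFunction

/-- For a finite group `G` and subgroups `H, K ≤ G`, `H` and `K` are almost conjugate
if and only if for every finite-dimensional complex representation `ρ` of `G`,
the dimensions of the fixed subspaces of `ρ(H)` and `ρ(K)` agree. -/
theorem almostConjugate_iff_fixed_dims_eq {G : Type*} [Group G] [Finite G]
    (H K : Subgroup G) :
    AlmostConjugate H K ↔
      ∀ (V : Type) [AddCommGroup V] [Module ℂ V] [FiniteDimensional ℂ V]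
        (ρ : Representation ℂ G V),
        Module.finrank ℂ (fixedSubspace ρ H) = Module.finrank ℂ (fixedSubspace ρ K) := by
  have := Fintype.ofFinite G
  have hG : (Nat.card G : ℂ) ≠ 0 := Nat.cast_ne_zero.2 Nat.card_pos.ne'
  have hH : (Nat.card H : ℂ) ≠ 0 := Nat.cast_ne_zero.2 Nat.card_pos.ne'
  constructor
  · intro h V _ _ _ ρ
    have hsum := sum_conjugatorCount_mul_character ρ H
    rw [(almostConjugate_iff_conjugatorCount_eq H K).1 h, sum_conjugatorCount_mul_character ρ K,
      ← h.card_eq] at hsum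
    exact_mod_cast (mul_left_cancel₀ hH (mul_left_cancel₀ hG hsum)).symm
  · intro h
    let F : G → ℂ := fun x =>
      Nat.card K * conjugatorCount H x - Nat.card H * conjugatorCount K x
    have hF : F = 0 := by
      refine classFunction_eq_zero_of_sum_mul_character_eq_zero ?_ ?_ fun n ρ => ?_
      · simp [F, conjugatorCount_conj]
      · simp [F, conjugatorCount_inv]
      · simp only [F, sub_mul, mul_assoc, Finset.sum_sub_distrib, ← Finset.mul_sum,
          sum_conjugatorCount_mul_character, h]
        ring
    have hcard : (Nat.card K : ℂ) = Nat.card H := by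
      have h1 := congrFun hF 1
      simp only [F, conjugatorCount_one, Pi.zero_apply, sub_eq_zero] at h1
      exact mul_right_cancel₀ hG h1
    rw [almostConjugate_iff_conjugatorCount_eq]
    ext x
    have hx := congrFun hF x
    simp only [F, hcard, Pi.zero_apply, sub_eq_zero] at hx
    exact_mod_cast mul_left_cancel₀ hH hx
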